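/- arXiv:1105.1867 — 2 statements merged into one kernel-verified Lean document; each statement's English description precedes it below -/
import Mathlib

section
/- Let (E₁,E₂,E₃,κ,τ) be a pseudo-Galilean Frenet frame, let γ : ℝ → ℝ be differentiable and φ ∈ ℝ a nonzero constant, and suppose cos(γ(s)) ≠ 0 for every s. If the hyperbolically rotated frame (Ẽ₁,Ẽ₂,Ẽ₃) of (E₁,E₂,E₃) with angles γ, φ satisfies the third pseudo-Galilean Frenet equation Ẽ₃' = τ̃·Ẽ₂ for some function τ̃ : ℝ → ℝ, then the torsion is preserved, τ̃(s) = τ(s) for all s, and γ satisfies the differential equation dγ/ds = τ(s)·sin(γ(s))·tanh(φ/2). -/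
open Real

theorem cosh_sub_one_eq_tanh_half_mul_sinh (x : ℝ) :
    Real.cosh x - 1 = Real.tanh (x / 2) * Real.sinh x := by
  have hc : Real.cosh (x / 2) ≠ 0 := (Real.cosh_pos _).ne'
  have h₁ := Real.cosh_two_mul (x / 2)
  have h₂ := Real.sinh_two_mul (x / 2)
  have h₃ := Real.cosh_sq (x / 2)
  rw [mul_div_cancel₀ x two_ne_zero] at h₁ h₂
  rw [h₁, h₂, h₃, Real.tanh_eq_sinh_div_cosh]
  field_simp
  ring

theorem eq_of_linearIndependent_triple {V : Type*} [AddCommGroup V] [Module ℝ V] {u v w : V}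
    (h : LinearIndependent ℝ ![u, v, w]) {a b c a' b' c' : ℝ}
    (heq : a • u + b • v + c • w = a' • u + b' • v + c' • w) :
    a = a' ∧ b = b' ∧ c = c' := by
  have h0 := Fintype.linearIndependent_iff.1 h ![a - a', b - b', c - c'] (by
    simp only [Fin.sum_univ_three, Matrix.cons_val]
    linear_combination (norm := module) heq)
  exact ⟨sub_eq_zero.1 (h0 0), sub_eq_zero.1 (h0 1), sub_eq_zero.1 (h0 2)⟩

theorem stmt4
    (E₁ E₂ E₃ : ℝ → Fin 3 → ℝ) (κ τ : ℝ → ℝ)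
    (hE₁ : Differentiable ℝ E₁) (hE₂ : Differentiable ℝ E₂) (hE₃ : Differentiable ℝ E₃)
    (hκ : Differentiable ℝ κ) (hτ : Differentiable ℝ τ)
    (hLI : ∀ s : ℝ, LinearIndependent ℝ ![E₁ s, E₂ s, E₃ s])
    (hFr1 : ∀ s : ℝ, deriv E₁ s = κ s • E₂ s)
    (hFr2 : ∀ s : ℝ, deriv E₂ s = τ s • E₃ s)
    (hFr3 : ∀ s : ℝ, deriv E₃ s = τ s • E₂ s)
    (γ : ℝ → ℝ) (hγ : Differentiable ℝ γ)
    (φ : ℝ) (hφ : φ ≠ 0)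
    (hcosγ : ∀ s : ℝ, Real.cos (γ s) ≠ 0)
    (F₁ F₂ F₃ : ℝ → Fin 3 → ℝ)
    (hR1 : ∀ s : ℝ, F₁ s = (Real.cos (γ s) ^ 2 + Real.sin (γ s) ^ 2 * Real.cosh φ) • E₁ s + (Real.cos (γ s) * Real.sin (γ s) * (1 - Real.cosh φ)) • E₂ s + (-(Real.sin (γ s) * Real.sinh φ)) • E₃ s)
    (hR2 : ∀ s : ℝ, F₂ s = (Real.cos (γ s) * Real.sin (γ s) * (1 - Real.cosh φ)) • E₁ s + (Real.sin (γ s) ^ 2 + Real.cos (γ s) ^ 2 * Real.cosh φ) • E₂ s + (Real.cos (γ s) * Real.sinh φ) • E₃ s)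
    (hR3 : ∀ s : ℝ, F₃ s = (-(Real.sin (γ s) * Real.sinh φ)) • E₁ s + (Real.sinh φ * Real.cos (γ s)) • E₂ s + (Real.cosh φ) • E₃ s)
    (τ' : ℝ → ℝ)
    (hFr3' : ∀ s : ℝ, deriv F₃ s = τ' s • F₂ s) :
    (∀ s : ℝ, τ' s = τ s) ∧
    (∀ s : ℝ, deriv γ s = τ s * Real.sin (γ s) * Real.tanh (φ / 2)) := by
  have hsinh : Real.sinh φ ≠ 0 := Real.sinh_ne_zero.2 hφ
  have key (s : ℝ) :
      -(Real.cos (γ s) * deriv γ s * Real.sinh φ) =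
          τ' s * (Real.cos (γ s) * Real.sin (γ s) * (1 - Real.cosh φ)) ∧
        τ s * (Real.cos (γ s) * Real.sinh φ) = τ' s * (Real.cos (γ s) * Real.sinh φ) := by
    have hg := (hγ s).hasDerivAt
    have h₁ := (hE₁ s).hasDerivAt
    have h₂ := (hE₂ s).hasDerivAt
    have h₃ := (hE₃ s).hasDerivAt
    have hF := (((hg.sin.mul_const (Real.sinh φ)).neg.smul h₁).add
      ((hg.cos.const_mul (Real.sinh φ)).smul h₂)).add (h₃.const_smul (Real.cosh φ))
    have hd := (hF.congr_of_eventuallyEq (Filter.Eventually.of_forall hR3)).deriv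
    rw [hFr3' s, hR2 s, hFr1 s, hFr2 s, hFr3 s] at hd
    obtain ⟨ha, -, hc⟩ := eq_of_linearIndependent_triple (hLI s)
      (a := -(Real.cos (γ s) * deriv γ s * Real.sinh φ))
      (b := -(Real.sin (γ s) * Real.sinh φ) * κ s
        + Real.sinh φ * (-Real.sin (γ s) * deriv γ s) + Real.cosh φ * τ s)
      (c := τ s * (Real.cos (γ s) * Real.sinh φ))
      (a' := τ' s * (Real.cos (γ s) * Real.sin (γ s) * (1 - Real.cosh φ)))
      (b' := τ' s * (Real.sin (γ s) ^ 2 + Real.cos (γ s) ^ 2 * Real.cosh φ))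
      (c' := τ' s * (Real.cos (γ s) * Real.sinh φ)) (by
        simp only [Pi.neg_apply] at hd
        linear_combination (norm := module) -hd)
    exact ⟨ha, hc⟩
  have hτ' (s : ℝ) : τ' s = τ s :=
    (mul_right_cancel₀ (mul_ne_zero (hcosγ s) hsinh) (key s).2).symm
  refine ⟨hτ', fun s => mul_right_cancel₀ (mul_ne_zero (hcosγ s) hsinh) ?_⟩
  have h := (key s).1
  rw [hτ' s] at h
  linear_combination -h + τ s * Real.cos (γ s) * Real.sin (γ s) *
    cosh_sub_one_eq_tanh_half_mul_sinh φ
end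

section
/- Let (E₁,E₂,E₃,E₄,κ,τ,σ) be a Galilean Frenet frame in G⁴, let γ : ℝ → ℝ be differentiable, φ ∈ ℝ a constant with sin φ ≠ 0, r ∈ ℝ a nonzero constant, and suppose sin(γ(s)) ≠ 0 for every s. Let α, α̃ : ℝ → ℝ⁴ be differentiable curves with α' = E₁, α̃' = Ẽ₁ (the first vector of the spatially rotated frame of (E₁,E₂,E₃,E₄) with angles γ, φ), and suppose the distance vector satisfies α̃(s) − α(s) = r·(cos(γ(s))·E₁(s) + sin(γ(s))·E₂(s)) for all s. Then τ(s) = sin φ / r for all s (so the torsion τ is constant), and γ satisfies the differential equation dγ/ds = τ(s)·sin(γ(s))·tan(φ/2) − κ(s). -/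
open Real

theorem LinearIndependent.coeff_eq_zero_of_vec4 {V : Type*} [AddCommGroup V] [Module ℝ V]
    {u v w x : V} (h : LinearIndependent ℝ ![u, v, w, x]) {a b c : ℝ}
    (habc : a • u + b • v + c • w = 0) : a = 0 ∧ b = 0 ∧ c = 0 := by
  have key := Fintype.linearIndependent_iff.1 h ![a, b, c, 0]
    (by simpa [Fin.sum_univ_four] using habc)
  exact ⟨key 0, key 1, key 2⟩

theorem Real.sin_mul_tan_half {φ : ℝ} (hφ : Real.sin φ ≠ 0) :
    Real.sin φ * Real.tan (φ / 2) = 1 - Real.cos φ := by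
  obtain ⟨x, rfl⟩ : ∃ x, φ = 2 * x := ⟨φ / 2, by ring⟩
  have hx : Real.cos x ≠ 0 := fun h => hφ (by rw [Real.sin_two_mul, h, mul_zero])
  rw [mul_div_cancel_left₀ x two_ne_zero, Real.tan_eq_sin_div_cos, Real.sin_two_mul,
    Real.cos_two_mul]
  field_simp
  linear_combination 2 * Real.sin_sq_add_cos_sq x

theorem stmt12
    (E₁ E₂ E₃ E₄ : ℝ → Fin 4 → ℝ) (κ τ σ : ℝ → ℝ)
    (hE₁ : Differentiable ℝ E₁) (hE₂ : Differentiable ℝ E₂)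
    (hE₃ : Differentiable ℝ E₃) (hE₄ : Differentiable ℝ E₄)
    (hκ : Differentiable ℝ κ) (hτ : Differentiable ℝ τ) (hσ : Differentiable ℝ σ)
    (hLI : ∀ s : ℝ, LinearIndependent ℝ ![E₁ s, E₂ s, E₃ s, E₄ s])
    (hFr1 : ∀ s : ℝ, deriv E₁ s = κ s • E₂ s)
    (hFr2 : ∀ s : ℝ, deriv E₂ s = (-(κ s)) • E₁ s + τ s • E₃ s)
    (hFr3 : ∀ s : ℝ, deriv E₃ s = (-(τ s)) • E₂ s)
    (hFr4 : ∀ s : ℝ, deriv E₄ s = (-(σ s)) • E₃ s)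
    (γ : ℝ → ℝ) (hγ : Differentiable ℝ γ)
    (φ : ℝ) (hφ : Real.sin φ ≠ 0)
    (r : ℝ) (hr : r ≠ 0)
    (hsinγ : ∀ s : ℝ, Real.sin (γ s) ≠ 0)
    (F₁ F₂ F₃ F₄ : ℝ → Fin 4 → ℝ)
    (hR1 : ∀ s : ℝ, F₁ s = (Real.cos (γ s) ^ 2 + Real.sin (γ s) ^ 2 * Real.cos φ) • E₁ s + (Real.cos (γ s) * Real.sin (γ s) * (1 - Real.cos φ)) • E₂ s + (Real.sin (γ s) * Real.sin φ) • E₃ s)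
    (hR2 : ∀ s : ℝ, F₂ s = (Real.cos (γ s) * Real.sin (γ s) * (1 - Real.cos φ)) • E₁ s + (Real.sin (γ s) ^ 2 + Real.cos (γ s) ^ 2 * Real.cos φ) • E₂ s + (-(Real.cos (γ s) * Real.sin φ)) • E₃ s)
    (hR3 : ∀ s : ℝ, F₃ s = (-(Real.sin (γ s) * Real.sin φ)) • E₁ s + (Real.sin φ * Real.cos (γ s)) • E₂ s + (Real.cos φ) • E₃ s)
    (hR4 : ∀ s : ℝ, F₄ s = E₄ s)
    (α α' : ℝ → Fin 4 → ℝ)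
    (hα : Differentiable ℝ α) (hα' : Differentiable ℝ α')
    (hαE : ∀ s : ℝ, deriv α s = E₁ s)
    (hα'E : ∀ s : ℝ, deriv α' s = F₁ s)
    (hdist : ∀ s : ℝ, α' s - α s = r • (Real.cos (γ s) • E₁ s + Real.sin (γ s) • E₂ s))
    :
    (∀ s : ℝ, τ s = Real.sin φ / r) ∧
    (∀ s : ℝ, deriv γ s = τ s * Real.sin (γ s) * Real.tan (φ / 2) - κ s) := by
  have key : ∀ s : ℝ, τ s = Real.sin φ / r ∧
      r * (deriv γ s + κ s) = Real.sin (γ s) * (1 - Real.cos φ) := by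
    intro s
    have hγs := (hγ s).hasDerivAt
    have hd := ((hγs.cos.smul (hE₁ s).hasDerivAt).add
      (hγs.sin.smul (hE₂ s).hasDerivAt)).const_smul r
    have hd' := (hα' s).hasDerivAt.sub (hα s).hasDerivAt
    have heq := hd'.unique (hd.congr_of_eventuallyEq (Filter.Eventually.of_forall hdist))
    rw [hα'E, hαE, hR1, hFr1, hFr2] at heq
    obtain ⟨h1, -, h3⟩ := (hLI s).coeff_eq_zero_of_vec4
      (a := Real.cos (γ s) ^ 2 + Real.sin (γ s) ^ 2 * Real.cos φ - 1
        + r * Real.sin (γ s) * (deriv γ s + κ s))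
      (b := Real.cos (γ s) * Real.sin (γ s) * (1 - Real.cos φ)
        - r * Real.cos (γ s) * (deriv γ s + κ s))
      (c := Real.sin (γ s) * Real.sin φ - r * Real.sin (γ s) * τ s)
      (by
        rw [← sub_eq_zero] at heq
        rw [← heq]
        module)
    constructor
    · rw [eq_div_iff hr]
      apply mul_left_cancel₀ (hsinγ s)
      linear_combination -h3
    · apply mul_left_cancel₀ (hsinγ s)
      linear_combination h1 - Real.sin_sq_add_cos_sq (γ s)
  refine ⟨fun s => (key s).1, fun s => ?_⟩
  obtain ⟨hτs, hγs⟩ := key s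
  apply mul_left_cancel₀ hr
  have hτr : τ s * r = Real.sin φ := by rw [hτs, div_mul_cancel₀ _ hr]
  linear_combination hγs - Real.sin (γ s) * Real.sin_mul_tan_half hφ
    - Real.sin (γ s) * Real.tan (φ / 2) * hτr
end
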